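/- arXiv:1910.10876 — 2 statements merged into one kernel-verified Lean document; each statement's English description precedes it below -/
import Mathlib

section
/- Let k ≥ 3 be a fixed integer. For every ε > 0 there exists N such that for all n ≥ N: if (E,K) is a dominating set of G_{k,2} with |E| + |K| = γ(G_{k,2}) (i.e., minimizing |E|+|K|), then |E| ≥ (1/(2(k−1)) − ε) · n². -/
/-- `(E, K)` is a dominating set of the bipartite graph `G_{k,l}` whose vertex
classes are the `k`-element and `l`-element subsets of `[n] = {1, …, n}`
(modelled as `Finset.range n`), a `k`-set `A` being adjacent to an `l`-set `B`
iff `B ⊆ A`. -/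
def IsDomSet (n k l : ℕ) (E K : Finset (Finset ℕ)) : Prop :=
  (∀ e ∈ E, e ⊆ Finset.range n ∧ e.card = l) ∧
  (∀ A ∈ K, A ⊆ Finset.range n ∧ A.card = k) ∧
  (∀ A, A ⊆ Finset.range n → A.card = k → A ∉ K → ∃ e ∈ E, e ⊆ A) ∧
  (∀ e, e ⊆ Finset.range n → e.card = l → e ∉ E → ∃ A ∈ K, e ⊆ A)

/-- The domination number `γ(G_{k,l})`: the minimum of `|E| + |K|` over all
dominating sets `(E, K)` of `G_{k,l}`. -/
noncomputable def gamma (n k l : ℕ) : ℕ :=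
  sInf {m | ∃ E K : Finset (Finset ℕ), IsDomSet n k l E K ∧ m = E.card + K.card}

namespace SimpleGraph

variable {V : Type*} [Fintype V]

/-- The weak quantitative form of Turán's theorem. -/
theorem CliqueFree.two_mul_mul_card_edgeFinset_le {G : SimpleGraph V} [DecidableRel G.Adj]
    {r : ℕ} (h : G.CliqueFree (r + 1)) :
    2 * r * G.edgeFinset.card ≤ (r - 1) * Fintype.card V ^ 2 := by
  have h' := h.card_edgeFinset_le
  simp only at h'
  rw [← card_edgeFinset_turanGraph] at h'
  exact (Nat.mul_le_mul_left _ h').trans mul_card_edgeFinset_turanGraph_le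

/-- Turán's theorem for graphs with no independent set of size `r + 1`. -/
theorem IndepSetFree.card_sq_le {G : SimpleGraph V}
    [DecidableRel G.Adj] {r : ℕ} (hr : 0 < r) (h : G.IndepSetFree (r + 1)) :
    Fintype.card V ^ 2 ≤ 2 * r * G.edgeFinset.card + r * Fintype.card V := by
  classical
  have hT := ((cliqueFree_compl G).2 h).two_mul_mul_card_edgeFinset_le
  have hle : (Fintype.card V).choose 2 ≤ G.edgeFinset.card + Gᶜ.edgeFinset.card := by
    rw [← card_edgeFinset_top_eq_card_choose_two]
    refine le_trans (Finset.card_le_card ?_) (Finset.card_union_le _ _)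
    intro e he
    induction e with
    | _ x y =>
      simp only [mem_edgeFinset, mem_edgeSet, top_adj, Finset.mem_union, compl_adj] at he ⊢
      tauto
  have h2 : Fintype.card V ^ 2 ≤ 2 * (Fintype.card V).choose 2 + Fintype.card V := by
    rw [Nat.choose_two_right, Nat.mul_div_cancel' (Nat.even_mul_pred_self _).two_dvd]
    cases Fintype.card V with
    | zero => simp
    | succ m => simp only [Nat.add_sub_cancel]; nlinarith
  obtain ⟨s, rfl⟩ : ∃ s, r = s + 1 := ⟨r - 1, by omega⟩
  simp only [Nat.add_sub_cancel] at hT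
  nlinarith [Nat.mul_le_mul_left (s + 1) h2, Nat.mul_le_mul_left (2 * (s + 1)) hle]

end SimpleGraph

/-- If every `(r + 1)`-subset of `M` contains a pair from `E`, then `M` spans many pairs
from `E`. -/
theorem card_sq_le_of_forall_exists_subset {α : Type*} [DecidableEq α] {r : ℕ} (hr : 0 < r)
    (M : Finset α) (E : Finset (Finset α))
    (h : ∀ A ⊆ M, A.card = r + 1 → ∃ e ∈ E, e.card = 2 ∧ e ⊆ A) :
    M.card ^ 2 ≤ 2 * r * (E.filter (· ⊆ M)).card + r * M.card := by
  classical
  let G : SimpleGraph M :=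
    { Adj := fun x y => x ≠ y ∧ ({x.1, y.1} : Finset α) ∈ E
      symm := ⟨fun x y hxy => ⟨hxy.1.symm, by rw [Finset.pair_comm]; exact hxy.2⟩⟩
      loopless := ⟨fun x hx => hx.1 rfl⟩ }
  have hG : G.IndepSetFree (r + 1) := by
    intro t ht
    obtain ⟨e, heE, he, heA⟩ := h (t.map (Function.Embedding.subtype _))
      (fun a ha => by
        obtain ⟨b, -, rfl⟩ := Finset.mem_map.1 ha
        exact b.2) (by rw [Finset.card_map, ht.card_eq])
    obtain ⟨x, y, hxy, rfl⟩ := Finset.card_eq_two.1 he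
    obtain ⟨x', hx', rfl⟩ := Finset.mem_map.1 (heA (Finset.mem_insert_self x {y}))
    obtain ⟨y', hy', rfl⟩ := Finset.mem_map.1 (heA (show y ∈ ({_, y} : Finset α) by simp))
    have hne : x' ≠ y' := fun h => hxy (by rw [h])
    exact ht.isIndepSet hx' hy' hne ⟨hne, heE⟩
  have hcard : G.edgeFinset.card ≤ (E.filter (· ⊆ M)).card := by
    refine Finset.card_le_card_of_injOn
      (fun e => e.toFinset.map (Function.Embedding.subtype _)) ?_ ?_
    · intro e he
      induction e with
      | _ x y =>
        have hadj : G.Adj x y := by simpa using he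
        have : (s(x, y)).toFinset.map (Function.Embedding.subtype (· ∈ M))
            = ({x.1, y.1} : Finset α) := by
          rw [Sym2.toFinset_mk_eq]; simp
        simp only [Finset.mem_coe, Finset.mem_filter, this]
        refine ⟨hadj.2, fun a ha => ?_⟩
        rcases Finset.mem_insert.1 ha with rfl | ha
        · exact x.2
        · rw [Finset.mem_singleton.1 ha]; exact y.2
    · intro e _ f _ hef
      have := Finset.map_injective _ hef
      refine Sym2.ext fun a => ?_
      rw [← Sym2.mem_toFinset, this, Sym2.mem_toFinset]
  have := SimpleGraph.IndepSetFree.card_sq_le hr hG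
  rw [Fintype.card_coe] at this
  nlinarith [Nat.mul_le_mul_left (2 * r) hcard]

/-- Double counting of the pairs `(A, M)` with `A ∈ F`, `A ⊆ M` and `M` an `m`-subset of `s`. -/
theorem sum_powersetCard_card_filter_subset {α : Type*} [DecidableEq α] {s : Finset α}
    {F : Finset (Finset α)} {m j : ℕ} (hF : ∀ A ∈ F, A ⊆ s ∧ A.card = j) (hj : j ≤ m) :
    ∑ M ∈ s.powersetCard m, (F.filter (· ⊆ M)).card
      = F.card * (s.card - j).choose (m - j) := by
  have := Finset.sum_card_bipartiteAbove_eq_sum_card_bipartiteBelow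
    (s := s.powersetCard m) (t := F) (fun M A => A ⊆ M)
  simp only [Finset.bipartiteAbove, Finset.bipartiteBelow] at this
  rw [this, Finset.sum_const_nat]
  intro A hA
  obtain ⟨hs, rfl⟩ := hF A hA
  exact Finset.card_filter_powersetCard_subset A s m hs hj

theorem gamma_le_choose {n k l : ℕ} (hl : l ≤ k) : gamma n k l ≤ n.choose l := by
  refine Nat.sInf_le ⟨(Finset.range n).powersetCard l, ∅, ⟨?_, ?_, ?_, ?_⟩, by simp⟩
  · intro e he
    exact Finset.mem_powersetCard.1 he
  · simp
  · intro A hA hAk _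
    obtain ⟨e, he, hel⟩ := Finset.exists_subset_card_eq (hl.trans hAk.ge)
    exact ⟨e, Finset.mem_powersetCard.2 ⟨he.trans hA, hel⟩, he⟩
  · intro e he hel h
    exact absurd (Finset.mem_powersetCard.2 ⟨he, hel⟩) h

/-- Supersaturation: averaging Turán's theorem over all `m`-subsets of `[n]`. -/
theorem IsDomSet.mul_choose_le {n r m : ℕ} (hr : 0 < r) (hm : r + 1 ≤ m)
    {E K : Finset (Finset ℕ)} (h : IsDomSet n (r + 1) 2 E K) :
    m ^ 2 * n.choose m ≤ 2 * r * (E.card * (n - 2).choose (m - 2))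
      + m ^ 2 * (K.card * (n - (r + 1)).choose (m - (r + 1))) + r * m * n.choose m := by
  have hE := sum_powersetCard_card_filter_subset (m := m) h.1 (by omega)
  have hK := sum_powersetCard_card_filter_subset (m := m) h.2.1 hm
  rw [Finset.card_range] at hE hK
  rw [← hE, ← hK, Finset.mul_sum, Finset.mul_sum]
  have hsum (c : ℕ) : c * n.choose m = ∑ _M ∈ (Finset.range n).powersetCard m, c := by
    rw [Finset.sum_const, smul_eq_mul, Finset.card_powersetCard, Finset.card_range, mul_comm]
  rw [hsum, hsum, ← Finset.sum_add_distrib, ← Finset.sum_add_distrib]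
  refine Finset.sum_le_sum fun M hM => ?_
  obtain ⟨hMn, rfl⟩ := Finset.mem_powersetCard.1 hM
  rcases (K.filter (· ⊆ M)).eq_empty_or_nonempty with hKM | hKM
  · have := card_sq_le_of_forall_exists_subset hr M E fun A hAM hA => by
      obtain ⟨e, he, heA⟩ := h.2.2.1 A (hAM.trans hMn) hA fun hAK =>
        Finset.notMem_empty A (hKM ▸ Finset.mem_filter.2 ⟨hAK, hAM⟩)
      exact ⟨e, he, (h.1 e he).2, heA⟩
    omega
  · have := Nat.mul_le_mul_left (M.card ^ 2) hKM.card_pos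
    simp only [Nat.succ_eq_add_one, zero_add, mul_one] at this
    omega

theorem choose_sub_le_choose_sub {n m a b : ℕ} (hab : a ≤ b) (hb : b ≤ m) (hmn : m ≤ n) :
    (n - b).choose (m - b) ≤ (n - a).choose (m - a) := by
  rw [← Nat.choose_symm (n := n - b) (by omega), ← Nat.choose_symm (n := n - a) (by omega),
    show n - b - (m - b) = n - m by omega, show n - a - (m - a) = n - m by omega]
  exact Nat.choose_le_choose _ (by omega)

/-- The supersaturation bound with the binomial coefficients cancelled. -/
theorem IsDomSet.card_mul_ge {n r m : ℕ} (hr : 2 ≤ r) (hm : r + 1 ≤ m) (hmn : m ≤ n)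
    {E K : Finset (Finset ℕ)} (h : IsDomSet n (r + 1) 2 E K) (hK : K.card ≤ n ^ 2) :
    ((m : ℝ) - r) * (n * (n - 1)) ≤ 2 * r * E.card * (m - 1) + m ^ 4 * n * 3 := by
  have h₁ := h.mul_choose_le (by omega) hm
  have h₂ := choose_sub_le_choose_sub (n := n) (m := m) (a := 3) (b := r + 1)
    (by omega) hm hmn
  obtain ⟨p, rfl⟩ : ∃ p, m = p + 3 := ⟨m - 3, by omega⟩
  obtain ⟨q, rfl⟩ : ∃ q, n = q + 3 := ⟨n - 3, by omega⟩
  have e₁ := Nat.add_one_mul_choose_eq (q + 2) (p + 2)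
  have e₂ := Nat.add_one_mul_choose_eq (q + 1) (p + 1)
  have e₃ := Nat.add_one_mul_choose_eq q p
  simp only [show q + 3 - 2 = q + 1 by omega, show p + 3 - 2 = p + 1 by omega,
    show q + 3 - 3 = q by omega, show p + 3 - 3 = p by omega] at h₁ h₂
  have hc : 0 < (q + 1).choose (p + 1) := Nat.choose_pos (by omega)
  have h₃ : (q + 3) ^ 2 * q.choose p ≤ 3 * (q + 3) * ((q + 1).choose (p + 1) * (p + 1)) := by
    rw [← e₃]
    nlinarith [Nat.zero_le (q * (q + 3) * q.choose p)]
  have h₄ : K.card * (q + 3 - (r + 1)).choose (p + 3 - (r + 1))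
      ≤ 3 * (q + 3) * ((q + 1).choose (p + 1) * (p + 1)) :=
    (Nat.mul_le_mul hK h₂).trans h₃
  have e₄ : (p + 3) * (p + 2) * (q + 3).choose (p + 3)
      = (q + 3) * (q + 2) * (q + 1).choose (p + 1) := by
    calc _ = (p + 2) * ((q + 3).choose (p + 3) * (p + 3)) := by ring
      _ = (q + 3) * ((q + 2).choose (p + 2) * (p + 2)) := by rw [← e₁]; ring
      _ = _ := by rw [← e₂]; ring
  have h₅ : (p + 3) ^ 2 * (q + 3).choose (p + 3)
      ≤ 2 * r * (E.card * (q + 1).choose (p + 1))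
        + (p + 3) ^ 2 * (3 * (q + 3) * ((q + 1).choose (p + 1) * (p + 1)))
        + r * (p + 3) * (q + 3).choose (p + 3) := h₁.trans (by gcongr)
  generalize (q + 1).choose (p + 1) = C at *
  generalize (q + 3).choose (p + 3) = D at *
  have hC : (0 : ℝ) < C := by exact_mod_cast hc
  have h₅' : ((p : ℝ) + 3) ^ 2 * D ≤ 2 * r * (E.card * C)
      + (p + 3) ^ 2 * (3 * (q + 3) * (C * (p + 1))) + r * (p + 3) * D := by exact_mod_cast h₅
  have e₄' : ((p : ℝ) + 3) * (p + 2) * D = (q + 3) * (q + 2) * C := by exact_mod_cast e₄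
  push_cast
  have h₆ : (((p : ℝ) + 3 - r) * ((q + 3) * (q + 2))) * C
      ≤ (2 * r * E.card * (p + 2) + (p + 3) ^ 2 * ((p + 2) * (p + 1)) * (q + 3) * 3) * C := by
    calc (((p : ℝ) + 3 - r) * ((q + 3) * (q + 2))) * C
        = (p + 2) * ((p + 3) ^ 2 * D - r * (p + 3) * D) := by
          linear_combination -((p : ℝ) + 3 - r) * e₄'
      _ ≤ (p + 2) * (2 * r * (E.card * C) + (p + 3) ^ 2 * (3 * (q + 3) * (C * (p + 1)))) := by
          gcongr
          linarith
      _ = _ := by ring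
  have h₇ := le_of_mul_le_mul_right h₆ hC
  have h₈ : ((p : ℝ) + 3) ^ 2 * ((p + 2) * (p + 1)) * (q + 3) * 3 ≤ (p + 3) ^ 4 * (q + 3) * 3 := by
    rw [show ((p : ℝ) + 3) ^ 4 = (p + 3) ^ 2 * ((p + 3) * (p + 3)) by ring]
    gcongr <;> norm_num
  calc _ = ((p : ℝ) + 3 - r) * ((q + 3) * (q + 2)) := by ring
    _ ≤ 2 * r * E.card * (p + 2) + (p + 3) ^ 4 * (q + 3) * 3 := by linarith
    _ = _ := by ring

/-- If `(E, K)` is a dominating set of `G_{k,2}` minimizing `|E| + |K|`, then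
`|E| ≥ n²/(2(k-1)) + o(n²)`. -/
theorem optimal_domset_E_lower (k : ℕ) (hk : 3 ≤ k) (ε : ℝ) (hε : 0 < ε) :
    ∃ N : ℕ, ∀ n : ℕ, N ≤ n → ∀ E K : Finset (Finset ℕ),
      IsDomSet n k 2 E K → E.card + K.card = gamma n k 2 →
      (1 / (2 * ((k : ℝ) - 1)) - ε) * (n : ℝ) ^ 2 ≤ (E.card : ℝ) := by
  obtain ⟨r, rfl⟩ : ∃ r, k = r + 1 := ⟨k - 1, by omega⟩
  obtain ⟨t, ht⟩ := exists_nat_gt (1 / ε)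
  obtain ⟨m, hm⟩ : ∃ m, m = r + 1 + t := ⟨_, rfl⟩
  refine ⟨3 * m ^ 4 + m, fun n hn E K h hEK => ?_⟩
  have hK : K.card ≤ n ^ 2 := by
    have := gamma_le_choose (n := n) (show 2 ≤ r + 1 by omega)
    have := Nat.choose_le_pow n 2
    omega
  have key := h.card_mul_ge (by omega) (show r + 1 ≤ m by omega) (by omega) hK
  have hn' : 3 * (m : ℝ) ^ 4 + m ≤ n := by exact_mod_cast hn
  have hm' : (m : ℝ) = r + 1 + t := by exact_mod_cast hm
  have hr : (2 : ℝ) ≤ r := by exact_mod_cast (show 2 ≤ r by omega)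
  have hεt : 1 ≤ ε * t := by
    have := (div_lt_iff₀ hε).1 ht
    linarith
  have hεm : 1 ≤ ε * (m - 1) := by
    rw [hm']
    nlinarith
  have hm1 : (0 : ℝ) < m - 1 := by nlinarith
  have hn0 : (0 : ℝ) ≤ n := n.cast_nonneg
  have hmain : (n : ℝ) ^ 2 - 2 * r * ε * n ^ 2 ≤ 2 * r * E.card := by
    refine le_of_mul_le_mul_right ?_ hm1
    have h₁ : 2 * r * (n : ℝ) ^ 2 * 1 ≤ 2 * r * n ^ 2 * (ε * (m - 1)) := by gcongr
    have h₂ : (3 * (m : ℝ) ^ 4 + m) * n ≤ n * n := by gcongr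
    nlinarith [mul_nonneg (by linarith : (0 : ℝ) ≤ r) hn0,
      mul_nonneg (by linarith : (0 : ℝ) ≤ r) (mul_nonneg hn0 hn0)]
  push_cast
  rw [add_sub_cancel_right]
  refine le_of_mul_le_mul_left ?_ (show (0 : ℝ) < 2 * r by linarith)
  calc 2 * (r : ℝ) * ((1 / (2 * r) - ε) * n ^ 2) = n ^ 2 - 2 * r * ε * n ^ 2 := by
        field_simp
    _ ≤ _ := hmain
end

section
/- Fix integers k ≥ 3 and s > 1. For every ε > 0 there exists N such that for all n ≥ N the following holds. Let (E,K) be a dominating set of G_{k,2} with |E| + |K| = γ(G_{k,2}), let K₀ be the family of those members of K that contain some member of E as a subset, and let K₁ be the family of those members of K − K₀ that lie in a connected component of the graph Q(K − K₀) having fewer than s vertices. Then |σ₂(K₁)| ≤ ε·n². -/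
/-- The auxiliary graph `Q(T)` on vertex set `T`: distinct `A, B ∈ T` are
adjacent iff `|A ∩ B| ≥ 2`. -/
def auxQ (T : Finset (Finset ℕ)) : SimpleGraph {A // A ∈ T} :=
  SimpleGraph.fromRel (fun A B => 2 ≤ (A.val ∩ B.val).card)

/-- The 2-shadow `σ₂(T)`: all 2-element subsets `{i, j}` contained in some
member of `T`. -/
def sigma2 (T : Finset (Finset ℕ)) : Finset (Finset ℕ) :=
  T.sup (fun A => A.powersetCard 2)

/-- The members of `T` lying in a connected component of `Q(T)` with fewer than
`s` vertices. -/
noncomputable def smallComponentMembers (s : ℕ) (T : Finset (Finset ℕ)) : Finset (Finset ℕ) :=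
  (T.attach.filter (fun A => ((auxQ T).connectedComponentMk A).supp.ncard < s)).image
    Subtype.val

open Finset SzemerediRegularity

/-- In a uniform pair `(V₁, V₂)` of density at least `d`, few vertices have fewer than
`d / 2 * #W₂` neighbours in a large subset `W₂` of `V₂`. -/
lemma SimpleGraph.IsUniform.card_low_degree_lt {α : Type*} {G : SimpleGraph α}
    [DecidableRel G.Adj] {d e : ℝ} (hed : e ≤ d / 2) {V₁ V₂ W₁ W₂ : Finset α}
    (hG : G.IsUniform e V₁ V₂) (hd : d ≤ G.edgeDensity V₁ V₂) (h₁ : W₁ ⊆ V₁) (h₂ : W₂ ⊆ V₂)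
    (hW₂ : #V₂ * e ≤ #W₂) (hW₂' : W₂.Nonempty) :
    (#{v ∈ W₁ | (#{w ∈ W₂ | G.Adj v w} : ℝ) < d / 2 * #W₂} : ℝ) < #V₁ * e := by
  set B := {v ∈ W₁ | (#{w ∈ W₂ | G.Adj v w} : ℝ) < d / 2 * #W₂}
  by_contra! hcon
  have he := hG.pos
  have hdens := hG ((filter_subset _ _).trans h₁) h₂ hcon hW₂
  have hlow : (G.edgeDensity B W₂ : ℝ) ≤ d / 2 := by
    rw [SimpleGraph.edgeDensity_def]
    push_cast
    apply div_le_of_le_mul₀ (by positivity) (by linarith)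
    have hcard : #(G.interedges B W₂) = ∑ v ∈ B, #{w ∈ W₂ | G.Adj v w} := by
      rw [SimpleGraph.interedges_def, card_filter, sum_product]
      exact sum_congr rfl fun v _ ↦ (card_filter _ _).symm
    rw [hcard]
    push_cast
    calc ∑ v ∈ B, (#{w ∈ W₂ | G.Adj v w} : ℝ) ≤ ∑ v ∈ B, d / 2 * #W₂ :=
          sum_le_sum fun v hv ↦ (mem_filter.1 hv).2.le
      _ = d / 2 * (#B * #W₂) := by rw [sum_const, nsmul_eq_mul]; ring
  rw [abs_lt] at hdens
  linarith [hdens.1]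

/-- Greedy embedding of cliques in a system of pairwise dense uniform pairs. -/
lemma SimpleGraph.exists_isClique_of_isUniform {α ι : Type*} [DecidableEq α] [DecidableEq ι]
    (G : SimpleGraph α) [DecidableRel G.Adj] {d e : ℝ} {k : ℕ} (hd₀ : 0 < d) (hd₁ : d ≤ 1)
    (he : 0 < e) (hed : e ≤ d / 2) (hke : k * e < (d / 2) ^ k) (V : ι → Finset α) (z : ι)
    (hV : ∀ i, (V i).Nonempty) (I : Finset ι) :
    ∀ (W : ι → Finset α) (β : ℝ), z ∉ I → #I ≤ k → (d / 2) ^ k ≤ β * (d / 2) ^ #I →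
      (∀ i ∈ insert z I, W i ⊆ V i ∧ β * #(V i) ≤ #(W i)) →
      (∀ i ∈ insert z I, ∀ j ∈ insert z I, i ≠ j →
        G.IsUniform e (V i) (V j) ∧ d ≤ G.edgeDensity (V i) (V j)) →
      ∃ C S : Finset α, #C = #I ∧ G.IsClique C ∧ (∀ c ∈ C, ∃ i ∈ I, c ∈ W i) ∧ S ⊆ W z ∧
        β * (d / 2) ^ #I * #(V z) ≤ #S ∧ ∀ c ∈ C, ∀ w ∈ S, G.Adj c w := by
  induction I using Finset.induction_on with
  | empty =>
    intro W β _ _ _ hW _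
    exact ⟨∅, W z, rfl, by simp, by simp, subset_rfl, by simpa using (hW z (by simp)).2, by simp⟩
  | insert i J hiJ ih =>
    intro W β hz hIk hβ hW hU
    rw [card_insert_of_notMem hiJ] at hIk hβ ⊢
    have hzi : z ≠ i := fun h ↦ hz (h ▸ mem_insert_self _ _)
    have hzJ : z ∉ J := fun h ↦ hz (mem_insert_of_mem h)
    have hk1 : (1 : ℝ) ≤ k := by exact_mod_cast (by omega : 1 ≤ k)
    have hpow : (d / 2) ^ (#J + 1) ≤ 1 := pow_le_one₀ (by positivity) (by linarith)
    have hpos : 0 < (d / 2) ^ (#J + 1) := by positivity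
    have hβ₀ : 0 < β := by
      by_contra! h
      have : 0 < (d / 2) ^ k := by positivity
      nlinarith
    have hβk : k * e < β := by nlinarith
    have heβ : e ≤ β := by nlinarith
    have hJ : ∀ j ∈ insert z J, j ∈ insert z (insert i J) ∧ i ≠ j := by
      intro j hj
      rcases mem_insert.1 hj with rfl | hj
      · exact ⟨by simp, hzi.symm⟩
      · exact ⟨by simp [hj], fun h ↦ hiJ (h ▸ hj)⟩
    have hVpos : ∀ j, (0 : ℝ) < #(V j) := fun j ↦ by exact_mod_cast (hV j).card_pos
    have hWi := hW i (by simp)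
    obtain ⟨v, hvW, hv⟩ : ∃ v ∈ W i, ∀ j ∈ insert z J,
        d / 2 * #(W j) ≤ (#{w ∈ W j | G.Adj v w} : ℝ) := by
      by_contra! hcon
      have hsub : W i ⊆ (insert z J).biUnion fun j ↦
          {v ∈ W i | (#{w ∈ W j | G.Adj v w} : ℝ) < d / 2 * #(W j)} := by
        intro v hv
        obtain ⟨j, hj, hlt⟩ := hcon v hv
        exact mem_biUnion.2 ⟨j, hj, mem_filter.2 ⟨hv, hlt⟩⟩
      have hle : (#(W i) : ℝ) ≤ ∑ j ∈ insert z J,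
          (#{v ∈ W i | (#{w ∈ W j | G.Adj v w} : ℝ) < d / 2 * #(W j)} : ℝ) := by
        exact_mod_cast (card_le_card hsub).trans card_biUnion_le
      have hle' : ∑ j ∈ insert z J,
          (#{v ∈ W i | (#{w ∈ W j | G.Adj v w} : ℝ) < d / 2 * #(W j)} : ℝ)
            ≤ ∑ j ∈ insert z J, #(V i) * e := by
        refine sum_le_sum fun j hj ↦ ?_
        obtain ⟨hj', hij⟩ := hJ j hj
        obtain ⟨hu, hdens⟩ := hU i (by simp) j hj' hij
        have hWj := hW j hj'
        have hWjpos : (0 : ℝ) < #(W j) := (mul_pos hβ₀ (hVpos j)).trans_le hWj.2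
        refine (hu.card_low_degree_lt hed hdens hWi.1 hWj.1 ?_ ?_).le
        · nlinarith [hVpos j]
        · exact card_pos.1 (by exact_mod_cast hWjpos)
      rw [sum_const, nsmul_eq_mul, card_insert_of_notMem hzJ] at hle'
      have hJk : ((#J + 1 : ℕ) : ℝ) ≤ k := by exact_mod_cast hIk
      have h3 : ((#J + 1 : ℕ) : ℝ) * (#(V i) * e) ≤ k * (#(V i) * e) := by
        have := hVpos i
        gcongr
      nlinarith [hVpos i, hWi.2]
    obtain ⟨C, S, hC, hCl, hCW, hS, hcard, hadj⟩ := ih (fun j ↦ {w ∈ W j | G.Adj v w})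
      (β * (d / 2)) hzJ (by omega) (by rw [pow_succ] at hβ; linarith) (by
        intro j hj
        refine ⟨(filter_subset _ _).trans (hW j (hJ j hj).1).1, ?_⟩
        have h1 := hv j hj
        have h2 := (hW j (hJ j hj).1).2
        nlinarith)
      (fun a ha b hb ↦ hU a (hJ a ha).1 b (hJ b hb).1)
    have hvC : ∀ c ∈ C, G.Adj v c := fun c hc ↦ by
      obtain ⟨j, -, hj⟩ := hCW c hc
      exact (mem_filter.1 hj).2
    have hvn : v ∉ C := fun h ↦ G.loopless.irrefl v (hvC v h)
    refine ⟨insert v C, S, by rw [card_insert_of_notMem hvn, hC], ?_, ?_,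
      hS.trans (filter_subset _ _), ?_, ?_⟩
    · rw [coe_insert]
      exact hCl.insert fun c hc _ ↦ hvC c hc
    · intro c hc
      rcases mem_insert.1 hc with rfl | hc
      · exact ⟨i, by simp, hvW⟩
      · obtain ⟨j, hj, hcj⟩ := hCW c hc
        exact ⟨j, by simp [hj], (mem_filter.1 hcj).1⟩
    · rw [pow_succ]
      linarith
    · intro c hc w hw
      rcases mem_insert.1 hc with rfl | hc
      · exact (mem_filter.1 (hS hw)).2
      · exact hadj c hc w hw

/-- A form of the clique removal lemma: up to deleting at most `δ * n ^ 2` pairs, a graph on `n`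
vertices containing a `k`-clique contains a `(k - 1)`-clique with at least `s` extensions to a
`k`-clique. -/
lemma exists_clique_extensions (k s : ℕ) {δ : ℝ} (hδ : 0 < δ) (hk : 0 < k) :
    ∃ N : ℕ, ∀ n : ℕ, N ≤ n → ∀ (G : SimpleGraph (Fin n)),
      ∃ D : Finset (Fin n × Fin n), (#D : ℝ) ≤ δ * (n : ℝ) ^ 2 ∧
        ∀ A : Finset (Fin n), G.IsNClique k A → (∀ x ∈ A, ∀ y ∈ A, x ≠ y → (x, y) ∉ D) →
          ∃ C S : Finset (Fin n), #C + 1 = k ∧ G.IsClique C ∧ s ≤ #S ∧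
            ∀ c ∈ C, ∀ w ∈ S, G.Adj c w := by
  classical
  set d : ℝ := min (δ / 12) 1
  have hd₀ : 0 < d := by positivity
  have hd₁ : d ≤ 1 := min_le_right _ _
  have hdδ : d ≤ δ / 12 := min_le_left _ _
  set e : ℝ := (d / 2) ^ k / (k + 1) with he
  have he₀ : 0 < e := by positivity
  have hke : k * e < (d / 2) ^ k := by
    have : (k + 1) * e = (d / 2) ^ k := by rw [he]; field_simp
    linarith
  have hed : e ≤ d / 2 := by
    have h1 : (d / 2) ^ k ≤ d / 2 := pow_le_of_le_one (by positivity) (by linarith) hk.ne'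
    have h2 : (1 : ℝ) ≤ k := by exact_mod_cast hk
    nlinarith
  set l : ℕ := ⌈4 / (δ / 3)⌉₊
  set M : ℕ := bound e l
  set T : ℕ := ⌈s / (d / 2) ^ k⌉₊
  refine ⟨max 1 (max l (M * T)), fun n hn G ↦ ?_⟩
  have hn1 : 1 ≤ n := (le_max_left _ _).trans hn
  have hnl : l ≤ n := (le_max_left _ _).trans ((le_max_right _ _).trans hn)
  have hnM : M * T ≤ n := (le_max_right _ _).trans ((le_max_right _ _).trans hn)
  have : Nonempty (Fin n) := ⟨⟨0, hn1⟩⟩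
  obtain ⟨P, hP₁, hP₂, hP₃, hP₄⟩ := szemeredi_regularity G he₀ (l := l) (by simpa using hnl)
  have hparts : 4 / (δ / 3) ≤ (#P.parts : ℝ) := (Nat.le_ceil _).trans (by exact_mod_cast hP₂)
  set D₁ := (P.nonUniforms G e).biUnion fun (U, V) ↦ U ×ˢ V
  set D₂ := P.parts.biUnion offDiag
  set D₃ := (P.sparsePairs G d).biUnion fun (U, V) ↦ G.interedges U V
  refine ⟨D₁ ∪ D₂ ∪ D₃, ?_, fun A hA hAD ↦ ?_⟩
  · have h1 : (#D₁ : ℝ) < 4 * e * #(univ : Finset (Fin n)) ^ 2 :=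
      hP₁.sum_nonUniforms_lt univ_nonempty he₀ hP₄
    have h2 : (#D₂ : ℝ) ≤ δ / 3 / 2 * #(univ : Finset (Fin n)) ^ 2 :=
      hP₁.card_biUnion_offDiag_le (by positivity) hparts
    have h3 : (#D₃ : ℝ) ≤ 4 * d * #(univ : Finset (Fin n)) ^ 2 :=
      hP₁.card_interedges_sparsePairs_le hd₀.le
    have h4 : (#(D₁ ∪ D₂ ∪ D₃) : ℝ) ≤ #D₁ + #D₂ + #D₃ := by
      exact_mod_cast (card_union_le _ _).trans (by gcongr; exact card_union_le _ _)
    rw [card_univ, Fintype.card_fin] at h1 h2 h3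
    have hn2 : (0 : ℝ) ≤ (n : ℝ) ^ 2 := by positivity
    nlinarith
  · obtain ⟨z, hz⟩ : A.Nonempty := card_pos.1 (by rw [hA.card_eq]; exact hk)
    have hmem : ∀ x, P.part x ∈ P.parts := fun x ↦ P.part_mem.2 (mem_univ x)
    have hself : ∀ x, x ∈ P.part x := fun x ↦ P.mem_part (mem_univ x)
    have hcard : #(A.erase z) + 1 = k := by rw [card_erase_add_one hz, hA.card_eq]
    obtain ⟨C, S, hC, hCl, -, -, hS, hadj⟩ := G.exists_isClique_of_isUniform hd₀ hd₁ he₀ hed hke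
      P.part z (fun i ↦ ⟨i, hself i⟩) (A.erase z) P.part 1 (notMem_erase _ _) (by omega)
      (by
        rw [one_mul]
        exact pow_le_pow_of_le_one (by positivity) (by linarith) (by omega))
      (fun i _ ↦ ⟨subset_rfl, by simp⟩)
      (by
        rw [insert_erase hz]
        intro x hx y hy hxy
        have hD := hAD x hx y hy hxy
        simp only [mem_union, not_or] at hD
        obtain ⟨⟨hx₁, hx₂⟩, hx₃⟩ := hD
        have hne : P.part x ≠ P.part y := fun h ↦ hx₂ <| mem_biUnion.2
          ⟨_, hmem x, mem_offDiag.2 ⟨hself x, h ▸ hself y, hxy⟩⟩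
        constructor
        · by_contra hu
          exact hx₁ <| mem_biUnion.2 ⟨(P.part x, P.part y),
            (P.mk_mem_nonUniforms _).2 ⟨hmem x, hmem y, hne, hu⟩,
            mem_product.2 ⟨hself x, hself y⟩⟩
        · by_contra! hu
          exact hx₃ <| mem_biUnion.2 ⟨(P.part x, P.part y),
            (P.mk_mem_sparsePairs _ _ _ _).2 ⟨hmem x, hmem y, hne, hu⟩,
            (G.mk_mem_interedges_iff).2
              ⟨hself x, hself y, hA.isClique hx hy hxy⟩⟩)
    refine ⟨C, S, by omega, hCl, ?_, hadj⟩
    have hTz : T ≤ #(P.part z) := by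
      have h1 := hP₁.average_le_card_part (hmem z)
      rw [card_univ, Fintype.card_fin] at h1
      refine le_trans ?_ h1
      have hp : 0 < #P.parts := card_pos.2 ⟨_, hmem z⟩
      rw [Nat.le_div_iff_mul_le hp]
      calc T * #P.parts ≤ T * M := by gcongr
        _ = M * T := mul_comm _ _
        _ ≤ n := hnM
    have hpos : (0 : ℝ) < (d / 2) ^ k := by positivity
    have hsT : (s : ℝ) ≤ (d / 2) ^ k * T := by
      rw [mul_comm, ← div_le_iff₀ hpos]
      exact Nat.le_ceil _
    have : (s : ℝ) ≤ #S := by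
      calc (s : ℝ) ≤ (d / 2) ^ k * T := hsT
        _ ≤ (d / 2) ^ #(A.erase z) * #(P.part z) := by
          gcongr ?_ * ?_
          · exact pow_le_pow_of_le_one (by positivity) (by linarith) (by omega)
          · exact_mod_cast hTz
        _ ≤ #S := by simpa using hS
    exact_mod_cast this

lemma mem_sigma2 {T : Finset (Finset ℕ)} {e : Finset ℕ} :
    e ∈ sigma2 T ↔ ∃ A ∈ T, e ⊆ A ∧ #e = 2 := by
  simp [sigma2, mem_sup, mem_powersetCard]

lemma smallComponentMembers_subset (s : ℕ) (T : Finset (Finset ℕ)) :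
    smallComponentMembers s T ⊆ T := by
  intro A hA
  obtain ⟨B, -, rfl⟩ := mem_image.1 hA
  exact B.2

lemma card_lt_of_mem_smallComponentMembers {s : ℕ} {T F : Finset (Finset ℕ)} {A : Finset ℕ}
    (hA : A ∈ smallComponentMembers s T) (hF : F ⊆ T) (hAF : ∀ B ∈ F, 2 ≤ #(A ∩ B)) :
    #F < s := by
  obtain ⟨A', hA', rfl⟩ := mem_image.1 hA
  refine lt_of_le_of_lt ?_ (mem_filter.1 hA').2
  rw [← Set.ncard_image_of_injective _ Subtype.val_injective, ← Set.ncard_coe_finset]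
  refine Set.ncard_le_ncard (fun B hB ↦ ⟨⟨B, hF hB⟩, ?_, rfl⟩) (Set.toFinite _)
  rw [SimpleGraph.ConnectedComponent.mem_supp_iff, SimpleGraph.ConnectedComponent.eq]
  by_cases h : A' = ⟨B, hF hB⟩
  · rw [h]
  · refine SimpleGraph.Adj.reachable ?_
    rw [auxQ, SimpleGraph.fromRel_adj]
    exact ⟨Ne.symm h, Or.inr (hAF B hB)⟩

/-- The graph on `Fin n` whose edges are the members of `σ₂(T)`. -/
def shadowGraph (n : ℕ) (T : Finset (Finset ℕ)) : SimpleGraph (Fin n) where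
  Adj x y := x ≠ y ∧ ({x.val, y.val} : Finset ℕ) ∈ sigma2 T
  symm := ⟨fun x y h ↦ ⟨h.1.symm, by rw [pair_comm]; exact h.2⟩⟩
  loopless := ⟨fun x h ↦ h.1 rfl⟩

/-- A `k`-clique in the shadow of a family of independent `k`-sets is an independent `k`-set. -/
lemma map_mem_of_isNClique_shadowGraph {n k : ℕ} {E K T : Finset (Finset ℕ)}
    (hEK : IsDomSet n k 2 E K) (hT : T ⊆ K \ K.filter (fun A => ∃ e ∈ E, e ⊆ A))
    {A : Finset (Fin n)} (hA : (shadowGraph n T).IsNClique k A) :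
    A.map Fin.valEmbedding ∈ K \ K.filter (fun A => ∃ e ∈ E, e ⊆ A) := by
  obtain ⟨hE, -, hdom, -⟩ := hEK
  have hno : ¬ ∃ e ∈ E, e ⊆ A.map Fin.valEmbedding := by
    rintro ⟨e, he, heA⟩
    obtain ⟨x, y, hxy, rfl⟩ := card_eq_two.1 (hE e he).2
    obtain ⟨x, hx, rfl⟩ := mem_map.1 (heA (mem_insert_self _ _))
    obtain ⟨y, hy, rfl⟩ := mem_map.1 (heA (mem_insert_of_mem (mem_singleton_self _)))
    obtain ⟨B, hB, heB, -⟩ := mem_sigma2.1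
      (hA.isClique hx hy (fun h ↦ hxy (h ▸ rfl))).2
    have hBT := mem_sdiff.1 (hT hB)
    exact hBT.2 (mem_filter.2 ⟨hBT.1, _, he, heB⟩)
  have hK : A.map Fin.valEmbedding ∈ K := by
    by_contra hK
    refine hno (hdom _ ?_ (by rw [card_map, hA.card_eq]) hK)
    intro x hx
    obtain ⟨x, -, rfl⟩ := mem_map.1 hx
    exact mem_range.2 x.2
  exact mem_sdiff.2 ⟨hK, fun h ↦ hno (mem_filter.1 h).2⟩

lemma two_le_card_inter {A B : Finset ℕ} {x y : ℕ} (hxy : x ≠ y) (hxA : x ∈ A) (hyA : y ∈ A)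
    (hxB : x ∈ B) (hyB : y ∈ B) : 2 ≤ #(A ∩ B) := by
  rw [← card_pair hxy]
  refine card_le_card ?_
  simp [insert_subset_iff, *]

lemma card_sigma2_le {k : ℕ} {T : Finset (Finset ℕ)} (hT : ∀ A ∈ T, #A = k) :
    #(sigma2 T) ≤ #T * k.choose 2 := by
  rw [sigma2, sup_eq_biUnion]
  exact card_biUnion_le_card_mul _ _ _ fun A hA ↦ by rw [card_powersetCard, hT A hA]

/-- Fix `k ≥ 3` and `s > 1`. If `(E, K)` is an optimal dominating set of
`G_{k,2}`, `K₀` consists of the members of `K` containing a member of `E`, and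
`K₁` consists of the members of `K - K₀` lying in components of `Q(K - K₀)` of
size less than `s`, then `|σ₂(K₁)| = o(n²)`. -/
theorem shadow_of_small_components_negligible (k s : ℕ) (hk : 3 ≤ k) (hs : 1 < s)
    (ε : ℝ) (hε : 0 < ε) :
    ∃ N : ℕ, ∀ n : ℕ, N ≤ n → ∀ E K K₀ K₁ : Finset (Finset ℕ),
      IsDomSet n k 2 E K → E.card + K.card = gamma n k 2 →
      K₀ = K.filter (fun A => ∃ e ∈ E, e ⊆ A) →
      K₁ = smallComponentMembers s (K \ K₀) →
      ((sigma2 K₁).card : ℝ) ≤ ε * (n : ℝ) ^ 2 := by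
  have hch : (0 : ℝ) < k.choose 2 := by exact_mod_cast Nat.choose_pos (by omega)
  have hs₀ : (0 : ℝ) < s := by exact_mod_cast (by omega : 0 < s)
  obtain ⟨N, hN⟩ := exists_clique_extensions k s
    (show 0 < ε / (s * k.choose 2) by positivity) (by omega)
  refine ⟨N, fun n hn E K K₀ K₁ hEK _ hK₀ hK₁ ↦ ?_⟩
  have hsub : K₁ ⊆ K \ K₀ := hK₁ ▸ smallComponentMembers_subset _ _
  have hKn : ∀ A ∈ K₁, A ⊆ range n ∧ #A = k := fun A hA ↦ hEK.2.1 A (mem_sdiff.1 (hsub hA)).1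
  obtain ⟨D, hD, hDA⟩ := hN n hn (shadowGraph n K₁)
  have hhit : ∀ A ∈ K₁, ∃ p ∈ D, p.1 ≠ p.2 ∧ p.1.val ∈ A ∧ p.2.val ∈ A := by
    intro A hA
    by_contra! hcon
    have hlt : ∀ m ∈ A, m < n := fun m hm ↦ mem_range.1 ((hKn A hA).1 hm)
    obtain ⟨C, S, hC, hCl, hS, hadj⟩ := hDA (A.attachFin hlt) ⟨by
        intro x hx y hy hxy
        refine ⟨hxy, mem_sigma2.2 ⟨A, hA, ?_, card_pair (Fin.val_injective.ne hxy)⟩⟩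
        simp only [mem_coe, mem_attachFin] at hx hy
        simp [insert_subset_iff, hx, hy], by rw [card_attachFin, (hKn A hA).2]⟩
      (by
        intro x hx y hy hxy hxyD
        exact hcon (x, y) hxyD hxy ((mem_attachFin _).1 hx) ((mem_attachFin _).1 hy))
    obtain ⟨a, ha, b, hb, hab⟩ := one_lt_card.1 (by omega : 1 < #C)
    obtain ⟨B, hB, habB, -⟩ := mem_sigma2.1 (hCl ha hb hab).2
    have hSC : ∀ w ∈ S, w ∉ C := fun w hw hwC ↦ (hadj w hwC w hw).1 rfl
    have hinj : Set.InjOn (fun w ↦ (insert w C).map Fin.valEmbedding) S := by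
      intro w hw w' hw' h
      have h' := map_injective _ h
      have hmem : w ∈ insert w' C := h' ▸ mem_insert_self _ _
      exact (mem_insert.1 hmem).resolve_right (hSC w hw)
    have hcard := card_lt_of_mem_smallComponentMembers (hK₁ ▸ hB)
      (F := S.image fun w ↦ (insert w C).map Fin.valEmbedding)
      (by
        intro F hF
        obtain ⟨w, hw, rfl⟩ := mem_image.1 hF
        subst hK₀
        refine map_mem_of_isNClique_shadowGraph hEK hsub ⟨?_, ?_⟩
        · rw [coe_insert]
          exact hCl.insert fun c hc _ ↦ (hadj c hc w hw).symm
        · rw [card_insert_of_notMem (hSC w hw), hC])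
      (by
        intro F hF
        obtain ⟨w, hw, rfl⟩ := mem_image.1 hF
        refine two_le_card_inter (Fin.val_injective.ne hab) (habB (by simp)) (habB (by simp))
          (mem_map_of_mem Fin.valEmbedding (mem_insert_of_mem ha))
          (mem_map_of_mem Fin.valEmbedding (mem_insert_of_mem hb)))
    rw [card_image_of_injOn hinj] at hcard
    omega
  have hK₁card : #K₁ ≤ #D * s := by
    calc #K₁ ≤ #(D.biUnion fun p ↦ {A ∈ K₁ | p.1 ≠ p.2 ∧ p.1.val ∈ A ∧ p.2.val ∈ A}) :=
          card_le_card fun A hA ↦ by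
            obtain ⟨p, hp, h⟩ := hhit A hA
            exact mem_biUnion.2 ⟨p, hp, mem_filter.2 ⟨hA, h⟩⟩
      _ ≤ #D * s := card_biUnion_le_card_mul _ _ _ fun p _ ↦ by
        rcases eq_empty_or_nonempty {A ∈ K₁ | p.1 ≠ p.2 ∧ p.1.val ∈ A ∧ p.2.val ∈ A} with
          h | ⟨A, hA⟩
        · simp [h]
        · obtain ⟨hA, hne, hp₁, hp₂⟩ := mem_filter.1 hA
          refine (card_lt_of_mem_smallComponentMembers (hK₁ ▸ hA)
            ((filter_subset _ _).trans hsub) fun B hB ↦ ?_).le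
          obtain ⟨-, -, hq₁, hq₂⟩ := mem_filter.1 hB
          exact two_le_card_inter (Fin.val_injective.ne hne) hp₁ hp₂ hq₁ hq₂
  calc (#(sigma2 K₁) : ℝ) ≤ #K₁ * k.choose 2 := by
        exact_mod_cast card_sigma2_le fun A hA ↦ (hKn A hA).2
    _ ≤ #D * s * k.choose 2 := by gcongr; exact_mod_cast hK₁card
    _ ≤ ε / (s * k.choose 2) * (n : ℝ) ^ 2 * s * k.choose 2 := by gcongr
    _ = ε * (n : ℝ) ^ 2 := by field_simp
end
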